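/- Let M ≥ 3 be an odd integer and χ̂ > 0, and let H_M(χ) := χ̂S_c·[[1, −ǧ^T R_e],[0, R_e]] + [[0, 0],[0, M̌_c R_o]] (which is invertible). Define K_M(χ) := (1, 0, …, 0) · H_M(χ)^{-1} · (1, ǧ^T)^T. Then K_M(χ) = (1, ǧ^T) · [χ̂S_c + [[0,0],[0, 2R_e Λ_+ R_e^T]]]^{-1} · (1, ǧ^T)^T, and K_M(χ) > 0. -/

import Mathlib

open Matrix

/-- The `((M−1)/2) × ((M−1)/2)` lower bidiagonal matrix `M̌_c` with (0-indexed)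
diagonal entries `√(2i+3)` and subdiagonal entries `√(2i+2)`. -/
noncomputable def McK (k : ℕ) : Matrix (Fin k) (Fin k) ℝ :=
  Matrix.of fun i j =>
    if (j : ℕ) = (i : ℕ) then Real.sqrt (2 * (i : ℕ) + 3)
    else if (j : ℕ) + 1 = (i : ℕ) then Real.sqrt (2 * (i : ℕ) + 2) else 0

/-- The symmetric block matrix `Ǎ_c = [[0, M̌_c],[M̌_cᵀ, 0]]`. -/
noncomputable def AcK (k : ℕ) : Matrix (Fin k ⊕ Fin k) (Fin k ⊕ Fin k) ℝ :=
  Matrix.fromBlocks 0 (McK k) (McK k)ᵀ 0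

/-- The vector `ǧ = (√2, 0, …, 0)ᵀ ∈ ℝ^k`. -/
noncomputable def gCheck (k : ℕ) : Fin k → ℝ :=
  fun i => if (i : ℕ) = 0 then Real.sqrt 2 else 0

/-- The matrix `H_M(χ) = χ̂ S_c [[1, −ǧᵀ R_e],[0, R_e]] + [[0,0],[0, M̌_c R_o]]`,
with blocks of sizes `1` and `(M−1)/2`. -/
noncomputable def Hmat (k : ℕ) (χ : ℝ)
    (S : Matrix (Fin 1 ⊕ Fin k) (Fin 1 ⊕ Fin k) ℝ)
    (Re Ro : Matrix (Fin k) (Fin k) ℝ) :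
    Matrix (Fin 1 ⊕ Fin k) (Fin 1 ⊕ Fin k) ℝ :=
  χ • (S * Matrix.fromBlocks 1
        (Matrix.of fun (_ : Fin 1) j => -(Matrix.vecMul (gCheck k) Re j)) 0 Re) +
    Matrix.fromBlocks 0 0 0 (McK k * Ro)

/-- `H_M(χ)` factors as a symmetric matrix times a block upper triangular one. -/
lemma Hmat_eq_mul {k : ℕ} (χ : ℝ) (S : Matrix (Fin 1 ⊕ Fin k) (Fin 1 ⊕ Fin k) ℝ)
    (Re Ro L : Matrix (Fin k) (Fin k) ℝ) (hMR : McK k * Ro = Re * L)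
    (hRR : (2 : ℝ) • (Re * Reᵀ) = 1) :
    Hmat k χ S Re Ro =
      (χ • S + Matrix.fromBlocks 0 0 0 ((2 : ℝ) • (Re * L * Reᵀ))) *
        Matrix.fromBlocks 1
          (Matrix.of fun (_ : Fin 1) j => -(Matrix.vecMul (gCheck k) Re j)) 0 Re := by
  have h : ((2 : ℝ) • Reᵀ) * Re = 1 := by
    rw [mul_eq_one_comm, Matrix.mul_smul, hRR]
  have h' : ((2 : ℝ) • (Re * L * Reᵀ)) * Re = Re * L := by
    rw [← Matrix.mul_smul, Matrix.mul_assoc, h, Matrix.mul_one]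
  rw [Hmat, Matrix.add_mul, Matrix.smul_mul, Matrix.fromBlocks_multiply, h', hMR]
  simp

/-- The row vector `(1, gᵀ)` is sent to `(1, 0, …, 0)` by `[[1, −gᵀ R],[0, R]]`. -/
lemma vecMul_fromBlocks_neg_vecMul {k : ℕ} (g : Fin k → ℝ) (R : Matrix (Fin k) (Fin k) ℝ) :
    Sum.elim (fun _ => (1 : ℝ)) g ᵥ*
        Matrix.fromBlocks (1 : Matrix (Fin 1) (Fin 1) ℝ)
          (Matrix.of fun (_ : Fin 1) j => -(Matrix.vecMul g R j)) 0 R =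
      Sum.elim (fun _ => (1 : ℝ)) 0 := by
  rw [Matrix.vecMul_fromBlocks]
  ext (i | j)
  · simp
  · simp [Matrix.vecMul, dotProduct]

/-- Adding a positive semidefinite lower right block preserves positive definiteness. -/
lemma posDef_smul_add_fromBlocks {k : ℕ} {χ : ℝ} (hχ : 0 < χ)
    {S : Matrix (Fin 1 ⊕ Fin k) (Fin 1 ⊕ Fin k) ℝ} (hS : S.PosDef)
    {D : Matrix (Fin k) (Fin k) ℝ} (hD : D.PosSemidef) :
    (χ • S + Matrix.fromBlocks 0 0 0 D).PosDef := by
  refine (hS.smul hχ).add_posSemidef (Matrix.PosSemidef.of_dotProduct_mulVec_nonneg ?_ fun x => ?_)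
  · exact Matrix.IsHermitian.fromBlocks Matrix.isHermitian_zero (by simp) hD.isHermitian
  · have h := hD.dotProduct_mulVec_nonneg (x ∘ Sum.inr)
    rw [Matrix.fromBlocks_mulVec]
    simpa [dotProduct, Fintype.sum_sum_type] using h

/-- `K_M(χ) = (1,0,…,0) H_M(χ)⁻¹ (1, ǧᵀ)ᵀ` satisfies
`K_M(χ) = (1, ǧᵀ) [χ̂ S_c + [[0,0],[0, 2 R_e Λ₊ R_eᵀ]]]⁻¹ (1, ǧᵀ)ᵀ` and `K_M(χ) > 0`. -/
theorem KM_formula_and_pos (M : ℕ) (hM : 3 ≤ M) (hModd : Odd M)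
    (χ : ℝ) (hχ : 0 < χ)
    (S : Matrix (Fin 1 ⊕ Fin ((M - 1) / 2)) (Fin 1 ⊕ Fin ((M - 1) / 2)) ℝ)
    (hS : S.PosDef)
    (Re Ro : Matrix (Fin ((M - 1) / 2)) (Fin ((M - 1) / 2)) ℝ)
    (Λ : Fin ((M - 1) / 2) → ℝ)
    (hRe : IsUnit Re.det) (hRo : IsUnit Ro.det) (hΛ : ∀ i, 0 < Λ i)
    (horth : (Matrix.fromBlocks Re Re Ro (-Ro))ᵀ * Matrix.fromBlocks Re Re Ro (-Ro) = 1)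
    (hdiag : AcK ((M - 1) / 2) * Matrix.fromBlocks Re Re Ro (-Ro) =
      Matrix.fromBlocks Re Re Ro (-Ro) *
        Matrix.fromBlocks (Matrix.diagonal Λ) 0 0 (-(Matrix.diagonal Λ)))
    (hMR : McK ((M - 1) / 2) * Ro = Re * Matrix.diagonal Λ)
    (hRR : (2 : ℝ) • (Re * Reᵀ) = 1) :
    (Sum.elim (fun _ => (1 : ℝ)) 0) ⬝ᵥ
        ((Hmat ((M - 1) / 2) χ S Re Ro)⁻¹ *ᵥ
          Sum.elim (fun _ => (1 : ℝ)) (gCheck ((M - 1) / 2))) =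
      (Sum.elim (fun _ => (1 : ℝ)) (gCheck ((M - 1) / 2))) ⬝ᵥ
        ((χ • S +
            Matrix.fromBlocks 0 0 0 ((2 : ℝ) • (Re * Matrix.diagonal Λ * Reᵀ)))⁻¹ *ᵥ
          Sum.elim (fun _ => (1 : ℝ)) (gCheck ((M - 1) / 2))) ∧
    0 < (Sum.elim (fun _ => (1 : ℝ)) 0) ⬝ᵥ
        ((Hmat ((M - 1) / 2) χ S Re Ro)⁻¹ *ᵥ
          Sum.elim (fun _ => (1 : ℝ)) (gCheck ((M - 1) / 2))) := by
  have hD : ((2 : ℝ) • (Re * Matrix.diagonal Λ * Reᵀ)).PosSemidef := by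
    have h := (Matrix.PosSemidef.diagonal fun i => (hΛ i).le).mul_mul_conjTranspose_same Re
    rw [Matrix.conjTranspose_eq_transpose_of_trivial] at h
    exact h.smul zero_le_two
  have hG := posDef_smul_add_fromBlocks hχ hS hD
  have key : (Sum.elim (fun _ => (1 : ℝ)) 0) ⬝ᵥ
        ((Hmat ((M - 1) / 2) χ S Re Ro)⁻¹ *ᵥ
          Sum.elim (fun _ => (1 : ℝ)) (gCheck ((M - 1) / 2))) =
      (Sum.elim (fun _ => (1 : ℝ)) (gCheck ((M - 1) / 2))) ⬝ᵥ
        ((χ • S +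
            Matrix.fromBlocks 0 0 0 ((2 : ℝ) • (Re * Matrix.diagonal Λ * Reᵀ)))⁻¹ *ᵥ
          Sum.elim (fun _ => (1 : ℝ)) (gCheck ((M - 1) / 2))) := by
    rw [Hmat_eq_mul χ S Re Ro _ hMR hRR, Matrix.mul_inv_rev, ← Matrix.mulVec_mulVec,
      Matrix.dotProduct_mulVec, ← vecMul_fromBlocks_neg_vecMul (gCheck _) Re,
      Matrix.vecMul_vecMul, Matrix.mul_nonsing_inv, Matrix.vecMul_one]
    rw [Matrix.det_fromBlocks_zero₂₁]
    simpa using hRe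
  refine ⟨key, ?_⟩
  rw [key]
  have hne : Sum.elim (fun _ : Fin 1 => (1 : ℝ)) (gCheck ((M - 1) / 2)) ≠ 0 := fun h => by
    simpa using congrFun h (Sum.inl 0)
  simpa using hG.inv.dotProduct_mulVec_pos hne
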